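/- There exists n₀ ≥ 1 such that for all n ≥ n₀ with n ∈ I and all k ∈ I_n: E_{τ_n}[Z_k] ≤ 4√2·α·(n−k)^{−1/2} whenever n/2 ≤ k ≤ n − n₀; E_{τ_n}[Z_k] ≤ 2√2·α·n·k^{−3/2} whenever n₀ ≤ k ≤ n/2; and E_{τ_n}[Z_k] ≤ ⌊n/k⌋ for all 1 ≤ k ≤ n. Similarly, there exist n₁ ≥ 1 and ς > 0 such that for all n ≥ n₁ with n ∈ I and all k ∈ I_n ∩ I: E_{τ_n}[Z_k] ≥ α·n·k^{−3/2}/2 whenever n₁ ≤ k ≤ n/2, and E_{τ_n}[Z_k] ≥ ς·n whenever 1 ≤ k ≤ n₁. -/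

import Mathlib

/-! Finite ordered rooted (plane) trees: a tree is a finite list of its root subtrees. -/
inductive PTree : Type where
  | node : List PTree → PTree

namespace PTree

/-- the number of nodes of the tree -/
def size : PTree → ℕ
  | node ts => 1 + (ts.attach.map (fun x => size x.1)).sum
decreasing_by
  have := List.sizeOf_lt_of_mem x.2
  simp only [node.sizeOf_spec]; omega

/-- the list of all subtrees rooted at the nodes of the tree -/
def subtrees : PTree → List PTree
  | node ts => node ts :: (ts.attach.map (fun x => subtrees x.1)).flatten
decreasing_by
  have := List.sizeOf_lt_of_mem x.2
  simp only [node.sizeOf_spec]; omega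

/-- the height of the tree (maximal distance from the root to a node) -/
def height : PTree → ℕ
  | node ts => (ts.attach.map (fun x => height x.1 + 1)).foldr max 0
decreasing_by
  have := List.sizeOf_lt_of_mem x.2
  simp only [node.sizeOf_spec]; omega

/-- the number of children of the root (`ξ_ε`) -/
def rootDeg : PTree → ℕ
  | node ts => ts.length

/-- the sizes of the subtrees rooted at the children of the root -/
def childSizes : PTree → List ℕ
  | node ts => ts.map size

/-- the sizes of the subtrees rooted at the children of the root,
sorted from largest to smallest -/
def sortedSizesDesc (T : PTree) : List ℕ :=
  T.childSizes.insertionSort (· ≥ ·)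

/-- `N_k`: the `k`-th largest among the sizes of the subtrees rooted at the children
of the root (`0` if there are fewer than `k` children) -/
def Nk (k : ℕ) (T : PTree) : ℕ := (sortedSizesDesc T).getD (k - 1) 0

/-- `N_{k+} = N_k + N_{k+1} + ⋯` -/
def NkPlus (k : ℕ) (T : PTree) : ℕ := ((sortedSizesDesc T).drop (k - 1)).sum

/-- the subtrees rooted at the nodes of the heavy path: starting at the root, always
continue to the first child of maximal subtree size -/
def heavyPath : PTree → List PTree
  | node ts =>
    node ts ::
      (match ts.attach.find? (fun x => x.1.size = ((ts.map size).foldr max 0)) with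
       | some x => heavyPath x.1
       | none => [])
decreasing_by
  have := List.sizeOf_lt_of_mem x.2
  simp only [node.sizeOf_spec]; omega

end PTree

/-- `Z_k`: the number of nodes `v` of the tree whose subtree has size `k` -/
def Zk (k : ℕ) (T : PTree) : ℕ := (T.subtrees.filter (fun s => s.size = k)).length

/-- the rank (`1` = largest) of the `i`-th child (0-based) among siblings whose subtree
sizes are given by the list `sizes`; ties are broken from left to right -/
def rankIn (sizes : List ℕ) (i : ℕ) : ℕ :=
  1 + ((List.range sizes.length).filter (fun j =>
        sizes.getD i 0 < sizes.getD j 0 ∨ (sizes.getD j 0 = sizes.getD i 0 ∧ j < i))).length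

mutual
/-- the number of nodes of the `k`-heavy tree: the root together with all nodes `v` such
that `v` and every non-root ancestor of `v` has rank at most `k` among its siblings -/
def heavySize (k : ℕ) : PTree → ℕ
  | .node ts => 1 + heavySizeAux k (ts.map PTree.size) 0 ts
def heavySizeAux (k : ℕ) (sizes : List ℕ) : ℕ → List PTree → ℕ
  | _, [] => 0
  | i, t :: rest =>
      (if rankIn sizes i ≤ k then heavySize k t else 0) + heavySizeAux k sizes (i + 1) rest
end

/-- `H*(v,ℓ)`: the height of the subtree rooted at the child of rank `ℓ` of the root of `v`
(`0` if there are fewer than `ℓ` children) -/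
def Hstar : PTree → ℕ → ℕ
  | .node ts, ℓ =>
    match (List.range ts.length).find? (fun i => rankIn (ts.map PTree.size) i = ℓ) with
    | some i => (ts.getD i (.node [])).height
    | none => 0

/-- the weight of a tree: the product over all nodes `v` of `p (number of children of v)` -/
noncomputable def weight (p : ℕ → ℝ) : PTree → ℝ
  | .node ts => p ts.length * (ts.attach.map (fun x => weight p x.1)).prod
decreasing_by
  have := List.sizeOf_lt_of_mem x.2
  simp only [PTree.node.sizeOf_spec]; omega

/-- the total weight of all trees of size `n` -/
noncomputable def treeSum (p : ℕ → ℝ) (n : ℕ) : ℝ :=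
  ∑' T : {T : PTree // T.size = n}, weight p T.1

/-- the probability of the event `A` under the conditional Galton-Watson tree `τ_n` -/
noncomputable def condProb (p : ℕ → ℝ) (n : ℕ) (A : PTree → Prop) : ℝ :=
  (∑' T : {T : PTree // T.size = n ∧ A T}, weight p T.1) / treeSum p n

/-- the expectation of `f` under the conditional Galton-Watson tree `τ_n` -/
noncomputable def condExp (p : ℕ → ℝ) (n : ℕ) (f : PTree → ℝ) : ℝ :=
  (∑' T : {T : PTree // T.size = n}, weight p T.1 * f T.1) / treeSum p n

/-- the variance of `f` under the conditional Galton-Watson tree `τ_n` -/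
noncomputable def condVar (p : ℕ → ℝ) (n : ℕ) (f : PTree → ℝ) : ℝ :=
  condExp p n (fun T => f T ^ 2) - (condExp p n f) ^ 2

/-- the set `I = {n ≥ 1 : Σ_{|T| = n} w(T) > 0}` of sizes of positive probability -/
def gwSupport (p : ℕ → ℝ) : Set ℕ := {n | 1 ≤ n ∧ 0 < treeSum p n}

/-- `P(S_m = x)` for the random walk `S_m = (ξ_1 - 1) + ⋯ + (ξ_m - 1)`, `ξ_i` i.i.d. `∼ p` -/
noncomputable def walkProb (p : ℕ → ℝ) (m : ℕ) (x : ℤ) : ℝ :=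
  ∑' a : Fin m → ℕ, if (∑ i, ((a i : ℤ) - 1)) = x then ∏ i, p (a i) else 0

/-- `I_n = {1 ≤ k ≤ n : P(S_{n-k} = 0) > 0}` -/
def walkSupportIn (p : ℕ → ℝ) (n : ℕ) : Set ℕ :=
  {k | 1 ≤ k ∧ k ≤ n ∧ 0 < walkProb p (n - k) 0}

/-- `h = gcd {i > 0 : p_i > 0}`, defined as the largest common divisor of the support -/
noncomputable def gcdSupp (p : ℕ → ℝ) : ℕ :=
  sSup {d : ℕ | 0 < d ∧ ∀ i : ℕ, 0 < i → 0 < p i → d ∣ i}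

/-- `α = h / (σ √(2π))` where `σ² = Σ i² p_i - 1` -/
noncomputable def gwAlpha (p : ℕ → ℝ) : ℝ :=
  (gcdSupp p : ℝ) /
    (Real.sqrt ((∑' i : ℕ, (i : ℝ) ^ 2 * p i) - 1) * Real.sqrt (2 * Real.pi))

/-- the moment `E[ξ^m] = Σ i^m p_i` is finite -/
def MomentFinite (p : ℕ → ℝ) (m : ℝ) : Prop :=
  Summable (fun i : ℕ => (i : ℝ) ^ m * p i)

namespace PTree

@[simp]
theorem size_node (ts : List PTree) : (node ts).size = 1 + (ts.map size).sum := by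
  rw [size, List.attach_map_val (f := size)]

theorem subtrees_node (ts : List PTree) :
    (node ts).subtrees = node ts :: (ts.map subtrees).flatten := by
  rw [subtrees, List.attach_map_val (f := subtrees)]

/-- The list of root subtrees of a tree. -/
def childForest : PTree → List PTree
  | node ts => ts

theorem size_pos (T : PTree) : 0 < T.size := by
  cases T; simp

theorem weight_node (p : ℕ → ℝ) (ts : List PTree) :
    weight p (node ts) = p ts.length * (ts.map (weight p)).prod := by
  rw [weight, List.attach_map_val (f := weight p)]

theorem zk_node (k : ℕ) (ts : List PTree) :
    Zk k (node ts) = (if (node ts).size = k then 1 else 0) + (ts.map (Zk k)).sum := by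
  have h : (ts.map subtrees).flatten.countP (fun s => s.size = k) = (ts.map (Zk k)).sum := by
    rw [List.countP_flatten, List.map_map]
    congr 1
    refine List.map_congr_left fun s _ => ?_
    simp [Zk, List.countP_eq_length_filter]
  rw [Zk, subtrees_node, ← List.countP_eq_length_filter, List.countP_cons, h, add_comm]
  simp

theorem induct {P : PTree → Prop} (h : ∀ ts : List PTree, (∀ t ∈ ts, P t) → P (node ts)) (T : PTree) :
    P T := by
  induction hn : T.size using Nat.strong_induction_on generalizing T with
  | _ n ih =>
    obtain ⟨ts⟩ := T
    refine h ts fun t ht => ih t.size ?_ t rfl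
    have := List.single_le_sum (l := ts.map size) (by simp) t.size (List.mem_map_of_mem ht)
    rw [size_node] at hn
    omega

theorem weight_nonneg {p : ℕ → ℝ} (hp : ∀ i, 0 ≤ p i) (T : PTree) : 0 ≤ weight p T := by
  induction T using induct with
  | h ts ih =>
    rw [weight_node]
    refine mul_nonneg (hp _) (List.prod_nonneg ?_)
    simpa using ih

/-- Subtrees of equal size are disjoint. -/
theorem zk_mul_le (k : ℕ) (T : PTree) : Zk k T * k ≤ T.size := by
  induction T using induct with
  | h ts ih =>
    rw [zk_node]
    have hsum : (ts.map (Zk k)).sum * k ≤ (ts.map size).sum := by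
      rw [← List.sum_map_mul_right]
      exact List.sum_le_sum ih
    split_ifs with h
    · have : (ts.map (Zk k)).sum = 0 := by
        rw [size_node] at h
        by_contra h0
        have := Nat.le_mul_of_pos_left k (Nat.pos_of_ne_zero h0)
        omega
      simp [this, h]
    · rw [size_node, zero_add]
      omega

theorem zk_le_div {k : ℕ} (hk : 0 < k) (T : PTree) : Zk k T ≤ T.size / k :=
  (Nat.le_div_iff_mul_le hk).2 (zk_mul_le k T)

theorem finite_forests_of_sum_size (n : ℕ) : {ts : List PTree | (ts.map size).sum = n}.Finite := by
  induction n using Nat.strong_induction_on with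
  | _ n ih =>
    refine (((Set.finite_Iio n).biUnion fun a ha => (Set.finite_Iio n).biUnion fun b hb =>
      (ih a ha).image2 (fun cs rest => node cs :: rest) (ih b hb)).union
        (Set.finite_singleton [])).subset ?_
    rintro (_ | ⟨⟨cs⟩, rest⟩) h
    · simp
    · left
      simp only [Set.mem_ofPred_eq, List.map_cons, size_node, List.sum_cons] at h
      simp only [Set.mem_iUnion, Set.mem_Iio]
      exact ⟨(cs.map size).sum, by omega, (rest.map size).sum, by omega, cs, rfl, rest, rfl, rfl⟩

/-- The finite set of trees of a given size. -/
noncomputable def trees (n : ℕ) : Finset PTree :=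
  ((((finite_forests_of_sum_size n).preimage (f := fun T => [T])
    (fun _ _ _ _ h => by simpa using h)).subset (t := {T | T.size = n})
      (fun T (hT : T.size = n) => by simpa using hT))).toFinset

@[simp]
theorem mem_trees {n : ℕ} {T : PTree} : T ∈ trees n ↔ T.size = n := by
  simp [trees]

/-- The finite set of forests with a given number of trees and given total size. -/
noncomputable def forests (i n : ℕ) : Finset (List PTree) :=
  ((finite_forests_of_sum_size n).subset (t := {ts | ts.length = i ∧ (ts.map size).sum = n})
    fun _ h => h.2).toFinset

@[simp]
theorem mem_forests {i n : ℕ} {ts : List PTree} :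
    ts ∈ forests i n ↔ ts.length = i ∧ (ts.map size).sum = n := by
  simp [forests]

@[simp]
theorem trees_zero : trees 0 = ∅ := by
  ext T
  simpa using (size_pos T).ne'

theorem length_le_sum_size (ts : List PTree) : ts.length ≤ (ts.map size).sum := by
  simpa using List.length_le_sum_of_one_le (ts.map size) (by
    simpa [Nat.one_le_iff_ne_zero] using fun t _ => (size_pos t).ne')

theorem sum_trees_succ (n : ℕ) (φ : PTree → ℝ) :
    ∑ T ∈ trees (n + 1), φ T =
      ∑ i ∈ Finset.range (n + 1), ∑ ts ∈ forests i n, φ (node ts) := by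
  rw [Finset.sum_sigma']
  symm
  refine Finset.sum_bij (fun x _ => node x.2) ?_ ?_ ?_ ?_
  · rintro ⟨i, ts⟩ h
    simp only [Finset.mem_sigma, mem_forests] at h
    simp [h.2.2, add_comm]
  · rintro ⟨i, ts⟩ h ⟨i', ts'⟩ h' e
    simp only [Finset.mem_sigma, mem_forests, node.injEq] at h h' e
    subst e
    obtain rfl := h.2.1
    obtain rfl := h'.2.1
    rfl
  · rintro ⟨ts⟩ h
    simp only [mem_trees, size_node] at h
    have := length_le_sum_size ts
    exact ⟨⟨ts.length, ts⟩, by simp; omega, rfl⟩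
  · simp

theorem sum_forests_succ (i n : ℕ) (φ : List PTree → ℝ) :
    ∑ ts ∈ forests (i + 1) n, φ ts =
      ∑ ab ∈ Finset.HasAntidiagonal.antidiagonal n, ∑ T ∈ trees ab.1,
        ∑ ts ∈ forests i ab.2, φ (T :: ts) := by
  simp_rw [← Finset.sum_product']
  rw [Finset.sum_sigma']
  symm
  refine Finset.sum_bij (fun x _ => x.2.1 :: x.2.2) ?_ ?_ ?_ ?_
  · rintro ⟨⟨a, b⟩, T, ts⟩ h
    simp only [Finset.mem_sigma, Finset.HasAntidiagonal.mem_antidiagonal, Finset.mem_product, mem_trees,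
      mem_forests] at h
    simp [h]
  · rintro ⟨⟨a, b⟩, T, ts⟩ h ⟨⟨a', b'⟩, T', ts'⟩ h' e
    simp only [Finset.mem_sigma, Finset.HasAntidiagonal.mem_antidiagonal, Finset.mem_product, mem_trees,
      mem_forests, List.cons.injEq] at h h' e
    obtain ⟨rfl, rfl⟩ := e
    obtain ⟨-, rfl, -, rfl⟩ := h
    obtain ⟨-, rfl, -, rfl⟩ := h'
    rfl
  · rintro (_ | ⟨T, ts⟩) h
    · simp at h
    · simp only [mem_forests, List.length_cons, add_left_inj, List.map_cons, List.sum_cons] at h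
      exact ⟨⟨(T.size, (ts.map size).sum), T, ts⟩, by simp [h], rfl⟩
  · simp

theorem sum_forests_zero (n : ℕ) (φ : List PTree → ℝ) :
    ∑ ts ∈ forests 0 n, φ ts = if n = 0 then φ [] else 0 := by
  split_ifs with h
  · have : forests 0 n = {[]} := by
      ext ts
      simp only [mem_forests, List.length_eq_zero_iff, Finset.mem_singleton, and_iff_left_iff_imp]
      rintro rfl
      simp [h]
    rw [this, Finset.sum_singleton]
  · refine Finset.sum_eq_zero fun ts hts => ?_
    simp only [mem_forests, List.length_eq_zero_iff] at hts
    obtain ⟨rfl, h'⟩ := hts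
    exact absurd h'.symm (by simpa using h)

end PTree

section

open PowerSeries PTree

/-- The generating series of the total weights of the trees of each size. -/
noncomputable def treeSeries (p : ℕ → ℝ) : PowerSeries ℝ :=
  mk fun n => ∑ T ∈ trees n, weight p T

/-- The generating series of the weighted counts of subtrees of size `k`. -/
noncomputable def fringeSeries (p : ℕ → ℝ) (k : ℕ) : PowerSeries ℝ :=
  mk fun n => ∑ T ∈ trees n, weight p T * Zk k T

theorem sum_forests_weight (p : ℕ → ℝ) (i n : ℕ) :
    ∑ ts ∈ forests i n, (ts.map (weight p)).prod = coeff n (treeSeries p ^ i) := by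
  induction i generalizing n with
  | zero => simp [sum_forests_zero, coeff_one]
  | succ i ih =>
    rw [sum_forests_succ, pow_succ', coeff_mul]
    refine Finset.sum_congr rfl fun ab _ => ?_
    simp_rw [List.map_cons, List.prod_cons, ← Finset.mul_sum, ih, treeSeries, coeff_mk,
      Finset.sum_mul]

theorem sum_forests_weight_mul (p : ℕ → ℝ) (k i n : ℕ) :
    ∑ ts ∈ forests i n, (ts.map (weight p)).prod * ((ts.map (Zk k)).sum : ℕ) =
      i * coeff n (fringeSeries p k * treeSeries p ^ (i - 1)) := by
  induction i generalizing n with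
  | zero => simp [sum_forests_zero]
  | succ i ih =>
    have key : ((i : ℝ) + 1) * coeff n (fringeSeries p k * treeSeries p ^ i) =
        coeff n (fringeSeries p k * treeSeries p ^ i) +
          coeff n (treeSeries p * (C (i : ℝ) * (fringeSeries p k * treeSeries p ^ (i - 1)))) := by
      rw [mul_left_comm, coeff_C_mul]
      rcases i with _ | i
      · simp
      · rw [Nat.add_sub_cancel, mul_left_comm, ← pow_succ']
        ring
    rw [sum_forests_succ, Nat.cast_succ, Nat.add_sub_cancel, key, coeff_mul, coeff_mul,
      ← Finset.sum_add_distrib]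
    refine Finset.sum_congr rfl fun ab _ => ?_
    simp_rw [coeff_C_mul, ← ih, ← sum_forests_weight, treeSeries, fringeSeries, coeff_mk,
      Finset.sum_mul, ← Finset.sum_add_distrib, Finset.mul_sum, ← Finset.sum_add_distrib]
    refine Finset.sum_congr rfl fun T _ => Finset.sum_congr rfl fun ts _ => ?_
    simp only [List.map_cons, List.prod_cons, List.sum_cons]
    push_cast
    ring

theorem coeff_treeSeries_succ (p : ℕ → ℝ) (n : ℕ) :
    coeff (n + 1) (treeSeries p) =
      ∑ i ∈ Finset.range (n + 1), p i * coeff n (treeSeries p ^ i) := by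
  rw [treeSeries, coeff_mk, sum_trees_succ]
  refine Finset.sum_congr rfl fun i _ => ?_
  rw [← treeSeries, ← sum_forests_weight, Finset.mul_sum]
  refine Finset.sum_congr rfl fun ts hts => ?_
  rw [weight_node, (mem_forests.1 hts).1]

theorem coeff_fringeSeries_succ (p : ℕ → ℝ) (k n : ℕ) :
    coeff (n + 1) (fringeSeries p k) =
      (if n + 1 = k then coeff k (treeSeries p) else 0) + ∑ i ∈ Finset.range (n + 1),
        p i * (i * coeff n (fringeSeries p k * treeSeries p ^ (i - 1))) := by
  have h (T : PTree) (hT : T ∈ trees (n + 1)) : weight p T * Zk k T =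
      (if n + 1 = k then weight p T else 0) +
        weight p T * ((T.childForest.map (Zk k)).sum : ℕ) := by
    obtain ⟨ts⟩ := T
    rw [zk_node, mem_trees.1 hT, childForest]
    split_ifs <;> push_cast <;> ring
  rw [fringeSeries, coeff_mk, Finset.sum_congr rfl h, Finset.sum_add_distrib, sum_trees_succ _
    (fun T => weight p T * ((T.childForest.map (Zk k)).sum : ℕ)), ← fringeSeries]
  congr 1
  · split_ifs with hk
    · rw [treeSeries, coeff_mk, hk]
    · simp
  · refine Finset.sum_congr rfl fun i _ => ?_
    rw [← sum_forests_weight_mul, Finset.mul_sum]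
    refine Finset.sum_congr rfl fun ts hts => ?_
    rw [weight_node, (mem_forests.1 hts).1, childForest, mul_assoc]

theorem walkProb_eq_coeff (p : ℕ → ℝ) {m N : ℕ} {x : ℤ} (h : (m : ℤ) + x = N) :
    walkProb p m x = coeff N (mk p ^ m) := by
  have hsum (a : Fin m → ℕ) : ∑ i, ((a i : ℤ) - 1) = x ↔ ∑ i, a i = N := by
    rw [Finset.sum_sub_distrib, ← Nat.cast_sum]
    simp only [Finset.sum_const, Finset.card_univ, Fintype.card_fin, nsmul_eq_mul, mul_one]
    omega
  have hprod : mk p ^ m = ∏ _i : Fin m, mk p := by simp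
  rw [hprod, coeff_prod, walkProb, ← Finsupp.equivFunOnFinite.tsum_eq,
    tsum_eq_sum (s := Finset.finsuppAntidiag Finset.univ N)]
  · refine Finset.sum_congr rfl fun l hl => ?_
    rw [Finset.mem_finsuppAntidiag] at hl
    simp [(hsum l).2 hl.1]
  · intro l hl
    rw [if_neg]
    rw [hsum]
    intro h'
    exact hl (Finset.mem_finsuppAntidiag.2 ⟨h', Finset.subset_univ _⟩)

theorem walkProb_eq_zero_of_neg (p : ℕ → ℝ) {m : ℕ} {x : ℤ} (h : (m : ℤ) + x < 0) :
    walkProb p m x = 0 := by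
  rw [walkProb]
  convert tsum_zero with a
  rw [if_neg]
  rw [Finset.sum_sub_distrib, ← Nat.cast_sum]
  simp only [Finset.sum_const, Finset.card_univ, Fintype.card_fin, nsmul_eq_mul, mul_one]
  omega

theorem X_dvd_treeSeries (p : ℕ → ℝ) : X ∣ treeSeries p := by
  rw [X_dvd_iff]
  simp [treeSeries, ← coeff_zero_eq_constantCoeff_apply]

theorem coeff_treeSeries_pow_of_lt (p : ℕ → ℝ) {n j : ℕ} (h : n < j) :
    coeff n (treeSeries p ^ j) = 0 :=
  X_pow_dvd_iff.1 (pow_dvd_pow_of_dvd (X_dvd_treeSeries p) j) n h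

theorem sum_range_treeSeries (p : ℕ → ℝ) {n N : ℕ} (j : ℕ) (h : n ≤ N) :
    ∑ i ∈ Finset.range (n + 1), p i * coeff n (treeSeries p ^ (i + j)) =
      ∑ i ∈ Finset.range (N + 1), p i * coeff n (treeSeries p ^ (i + j)) := by
  refine Finset.sum_subset (Finset.range_mono (by omega)) fun i _ hi => ?_
  rw [coeff_treeSeries_pow_of_lt, mul_zero]
  simp at hi
  omega

theorem coeff_treeSeries_pow_succ (p : ℕ → ℝ) (n j : ℕ) :
    coeff (n + 1) (treeSeries p ^ (j + 1)) =
      ∑ i ∈ Finset.range (n + 1), p i * coeff n (treeSeries p ^ (i + j)) := by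
  rw [pow_succ', coeff_mul, Finset.Nat.sum_antidiagonal_succ]
  have h0 : coeff 0 (treeSeries p) = 0 := by simp [treeSeries, coeff_mk, -coeff_zero_eq_constantCoeff]
  simp only [h0, zero_mul, zero_add, pow_add _ _ j, coeff_mul _ _ (_ ^ j), Finset.mul_sum]
  rw [Finset.sum_comm]
  refine Finset.sum_congr rfl fun ab hab => ?_
  have := sum_range_treeSeries p (n := ab.1) (N := n) 0
    (Finset.HasAntidiagonal.antidiagonal.fst_le hab)
  simp only [add_zero] at this
  rw [coeff_treeSeries_succ, this, Finset.sum_mul]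
  simp only [mul_assoc]

/-- Exchangeability of the steps of a walk with given endpoint. -/
theorem sum_antidiagonal_mul_coeff_pow (p : ℕ → ℝ) (m N : ℕ) :
    (m + 1 : ℝ) * ∑ ab ∈ Finset.HasAntidiagonal.antidiagonal N,
      p ab.1 * (ab.1 * coeff ab.2 (mk p ^ m)) = N * coeff N (mk p ^ (m + 1)) := by
  rcases N with _ | N
  · simp
  · have h := congrArg (coeff N) (derivative_pow (R := ℝ) (mk p) (m + 1))
    rw [coeff_derivative, Nat.add_sub_cancel, mul_assoc, ← map_natCast (C (R := ℝ)), coeff_C_mul,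
      mul_comm (_ ^ m), coeff_mul] at h
    rw [Finset.Nat.sum_antidiagonal_succ]
    simp only [coeff_derivative, coeff_mk] at h
    push_cast at h ⊢
    rw [mul_comm ((N : ℝ) + 1), h]
    simp [mul_assoc]

/-- Summation over the first step of a walk. -/
theorem coeff_mk_pow_succ (p : ℕ → ℝ) (m N : ℕ) :
    coeff N (mk p ^ (m + 1)) = ∑ ab ∈ Finset.HasAntidiagonal.antidiagonal N,
      p ab.1 * coeff ab.2 (mk p ^ m) := by
  rw [pow_succ', coeff_mul]
  simp

theorem sum_range_eq_sum_antidiagonal (φ : ℕ → ℝ) (ψ : ℕ → ℕ → ℝ) {N M : ℕ} (h : N ≤ M)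
    (hφ : ∀ i, i ≤ N → φ i = ψ i (N - i)) (h0 : ∀ i, N < i → φ i = 0) :
    ∑ i ∈ Finset.range (M + 1), φ i =
      ∑ ab ∈ Finset.HasAntidiagonal.antidiagonal N, ψ ab.1 ab.2 := by
  rw [Finset.Nat.sum_antidiagonal_eq_sum_range_succ,
    ← Finset.sum_subset (Finset.range_mono (show N + 1 ≤ M + 1 by omega))]
  · exact Finset.sum_congr rfl fun i hi => hφ i (by simp at hi; omega)
  · intro i _ hi
    exact h0 i (by simp at hi; omega)

/-- The Otter–Dwass formula for forests. -/
theorem mul_coeff_treeSeries_pow (p : ℕ → ℝ) (n j : ℕ) (h : j ≤ n) :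
    n * coeff n (treeSeries p ^ j) = j * coeff (n - j) (mk p ^ n) := by
  induction n generalizing j with
  | zero => obtain rfl : j = 0 := by omega
            simp
  | succ n ih =>
    rcases j with _ | j
    · simp [coeff_one]
    rcases n.eq_zero_or_pos with rfl | hn
    · obtain rfl : j = 0 := by omega
      rw [coeff_treeSeries_pow_succ]
      simp
    have hn' : (n : ℝ) ≠ 0 := by positivity
    refine mul_left_cancel₀ hn' ?_
    rw [coeff_treeSeries_pow_succ, mul_left_comm, Finset.mul_sum,
      sum_range_eq_sum_antidiagonal (N := n - j) _
        (fun i l => p i * (i * coeff l (mk p ^ n)) + j * (p i * coeff l (mk p ^ n)))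
        (by omega)]
    · have h1 := sum_antidiagonal_mul_coeff_pow p n (n - j)
      have h2 := coeff_mk_pow_succ p n (n - j)
      rw [Finset.sum_add_distrib, ← Finset.mul_sum, ← h2]
      rw [Nat.cast_sub (by omega)] at h1
      push_cast
      rw [mul_add, h1]
      ring
    · intro i hi
      rw [mul_left_comm, ih _ (by omega), show n - (i + j) = n - j - i by omega]
      push_cast
      ring
    · intro i hi
      rw [coeff_treeSeries_pow_of_lt _ (by omega)]
      simp

/-- The generating series of the return probabilities of the walk. -/
noncomputable def returnSeries (p : ℕ → ℝ) : PowerSeries ℝ :=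
  mk fun l => coeff l (mk p ^ l)

/-- Decomposition of a walk at the first passage time. -/
theorem coeff_treeSeries_pow_mul_returnSeries (p : ℕ → ℝ) (m j : ℕ) :
    coeff m (treeSeries p ^ j * returnSeries p) =
      if j ≤ m then coeff (m - j) (mk p ^ m) else 0 := by
  split_ifs with h
  swap
  · refine X_pow_dvd_iff.1 ?_ m (not_le.1 h)
    exact (pow_dvd_pow_of_dvd (X_dvd_treeSeries p) j).mul_right _
  induction m generalizing j with
  | zero => obtain rfl : j = 0 := by omega
            simp [returnSeries, -coeff_zero_eq_constantCoeff]
  | succ m ih =>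
    rcases j with _ | j
    · simp [returnSeries]
    rw [coeff_mul, Finset.Nat.sum_antidiagonal_succ, coeff_treeSeries_pow_of_lt _ (by omega),
      zero_mul, zero_add, Nat.add_sub_add_right, coeff_mk_pow_succ]
    have h1 (ab : ℕ × ℕ) (hab : ab ∈ Finset.HasAntidiagonal.antidiagonal m) :
        coeff (ab.1 + 1) (treeSeries p ^ (j + 1)) * coeff ab.2 (returnSeries p) =
        ∑ i ∈ Finset.range (m + 1),
          p i * (coeff ab.1 (treeSeries p ^ (i + j)) * coeff ab.2 (returnSeries p)) := by
      rw [coeff_treeSeries_pow_succ, sum_range_treeSeries p j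
        (Finset.HasAntidiagonal.antidiagonal.fst_le hab), Finset.sum_mul]
      simp only [mul_assoc]
    rw [Finset.sum_congr rfl h1, Finset.sum_comm]
    simp only [← Finset.mul_sum, ← coeff_mul]
    refine sum_range_eq_sum_antidiagonal _ (fun i l => p i * coeff l (mk p ^ m)) (by omega) ?_ ?_
    · intro i hi
      rw [ih _ (by omega), show m - (i + j) = m - j - i by omega]
    · intro i hi
      rw [X_pow_dvd_iff.1 ((pow_dvd_pow_of_dvd (X_dvd_treeSeries p) (i + j)).mul_right _) m
        (by omega), mul_zero]

theorem coeff_fringeSeries (p : ℕ → ℝ) {k : ℕ} (hk : 1 ≤ k) (n : ℕ) :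
    coeff n (fringeSeries p k) =
      coeff n (X ^ k * (C (coeff k (treeSeries p)) * returnSeries p)) := by
  induction n using Nat.strong_induction_on with
  | _ n ih =>
    rcases n with _ | n
    · rw [coeff_X_pow_mul', if_neg (by omega)]
      simp [fringeSeries, -coeff_zero_eq_constantCoeff]
    have h1 (i : ℕ) : coeff n (fringeSeries p k * treeSeries p ^ (i - 1)) =
        coeff n (X ^ k * (C (coeff k (treeSeries p)) *
          (treeSeries p ^ (i - 1) * returnSeries p))) := by
      rw [mul_comm (_ ^ (i - 1)), ← mul_assoc (C _), ← mul_assoc (X ^ k), coeff_mul, coeff_mul]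
      refine Finset.sum_congr rfl fun ab hab => ?_
      rw [ih]
      have := Finset.HasAntidiagonal.antidiagonal.fst_le hab
      omega
    rw [coeff_fringeSeries_succ]
    simp only [h1]
    simp only [coeff_X_pow_mul', coeff_C_mul, coeff_treeSeries_pow_mul_returnSeries]
    rcases lt_trichotomy (n + 1) k with h | h | h
    · simp [h.ne, not_le.2 h, show ¬ k ≤ n by omega]
    · simp [h, show ¬ k ≤ n by omega, returnSeries, -coeff_zero_eq_constantCoeff]
    · obtain ⟨m, rfl⟩ := Nat.exists_eq_add_of_le (show k ≤ n by omega)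
      have h2 := sum_antidiagonal_mul_coeff_pow p m (m + 1)
      push_cast at h2
      replace h2 := mul_left_cancel₀ (by positivity) h2
      rw [if_neg (by omega), if_pos (by omega), zero_add,
        show k + m + 1 - k = m + 1 by omega, returnSeries, coeff_mk, ← h2, Finset.mul_sum]
      refine sum_range_eq_sum_antidiagonal _
        (fun i l => coeff k (treeSeries p) * (p i * (i * coeff l (mk p ^ m)))) (by omega) ?_ ?_
      · intro i hi
        rcases i with _ | i
        · simp
        · rw [if_pos (by omega), if_pos (by omega), show k + m - k - (i + 1 - 1) = m + 1 - (i + 1) by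
            omega, show k + m - k = m by omega]
          ring
      · intro i hi
        rw [if_pos (by omega), if_neg (by omega)]
        simp

theorem tsum_size_eq (n : ℕ) (φ : PTree → ℝ) :
    ∑' T : {T : PTree // T.size = n}, φ T.1 = ∑ T ∈ trees n, φ T := by
  rw [← Finset.tsum_subtype (trees n) φ]
  exact ((Equiv.subtypeEquivRight fun T => mem_trees (n := n)).tsum_eq fun T => φ T.1).symm

theorem treeSum_eq (p : ℕ → ℝ) (n : ℕ) : treeSum p n = coeff n (treeSeries p) := by
  rw [treeSum, tsum_size_eq n (weight p), treeSeries, coeff_mk]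

/-- The Otter–Dwass formula. -/
theorem mul_treeSum (p : ℕ → ℝ) (n : ℕ) : n * treeSum p n = walkProb p n (-1) := by
  rcases n with _ | n
  · rw [walkProb_eq_zero_of_neg p (by norm_num)]
    simp
  · have := mul_coeff_treeSeries_pow p (n + 1) 1 (by omega)
    rw [treeSum_eq, walkProb_eq_coeff p (N := n) (by push_cast; ring)]
    simpa using this

theorem condExp_zk (p : ℕ → ℝ) {k n : ℕ} (hk : 1 ≤ k) (hkn : k ≤ n) :
    condExp p n (fun T => (Zk k T : ℝ)) =
      treeSum p k * walkProb p (n - k) 0 / treeSum p n := by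
  have h := coeff_fringeSeries p hk n
  rw [coeff_X_pow_mul', if_pos hkn, coeff_C_mul, returnSeries, coeff_mk, fringeSeries, coeff_mk] at h
  rw [condExp, tsum_size_eq n (fun T => weight p T * Zk k T), h, treeSum_eq p k,
    walkProb_eq_coeff p (N := n - k) (by simp)]

theorem condExp_zk_le {p : ℕ → ℝ} (hp : ∀ i, 0 ≤ p i) {k n : ℕ} (hk : 1 ≤ k)
    (hn : n ∈ gwSupport p) : condExp p n (fun T => (Zk k T : ℝ)) ≤ ((n / k : ℕ) : ℝ) := by
  rw [condExp, tsum_size_eq n (fun T => weight p T * Zk k T), div_le_iff₀ hn.2, treeSum,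
    tsum_size_eq n (weight p), Finset.mul_sum]
  refine Finset.sum_le_sum fun T hT => ?_
  rw [mul_comm]
  refine mul_le_mul_of_nonneg_right ?_ (weight_nonneg hp T)
  rw [← mem_trees.1 hT]
  exact_mod_cast zk_le_div hk T

theorem walkProb_nonneg {p : ℕ → ℝ} (hp : ∀ i, 0 ≤ p i) (m : ℕ) (x : ℤ) : 0 ≤ walkProb p m x := by
  refine tsum_nonneg fun a => ?_
  split_ifs
  · exact Finset.prod_nonneg fun i _ => hp _
  · exact le_rfl

theorem hasSum_walkProb (p : ℕ → ℝ) (m : ℕ) (x : ℤ) :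
    HasSum (fun a : ℕ => p a * walkProb p m (x - (a - 1))) (walkProb p (m + 1) x) := by
  rcases lt_or_ge ((m + 1 : ℕ) + x) 0 with h | h
  · rw [walkProb_eq_zero_of_neg p h]
    convert! hasSum_zero using 2 with a
    rw [walkProb_eq_zero_of_neg p (by push_cast at h; omega), mul_zero]
  · lift (m + 1 : ℕ) + x to ℕ using h with N hN
    have hzero (a : ℕ) (ha : N < a) : p a * walkProb p m (x - (a - 1)) = 0 := by
      rw [walkProb_eq_zero_of_neg p (by push_cast at hN; omega), mul_zero]
    have hcoeff (a : ℕ) (ha : a ≤ N) : p a * walkProb p m (x - (a - 1)) =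
        p a * coeff (N - a) (PowerSeries.mk p ^ m) := by
      rw [walkProb_eq_coeff p (N := N - a)]
      push_cast at hN
      omega
    rw [walkProb_eq_coeff p hN.symm, coeff_mk_pow_succ, ← sum_range_eq_sum_antidiagonal
      (fun a : ℕ => p a * walkProb p m (x - (a - 1)))
      (fun a l => p a * coeff l (PowerSeries.mk p ^ m)) le_rfl hcoeff hzero]
    refine hasSum_sum_of_ne_finset_zero fun a ha => hzero a ?_
    simp at ha
    omega

theorem walkProb_pos_of_mem_gwSupport {p : ℕ → ℝ} {n : ℕ} (hn : n ∈ gwSupport p) :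
    0 < walkProb p n (-1) := by
  rw [← mul_treeSum]
  exact mul_pos (Nat.cast_pos.2 hn.1) hn.2

theorem exists_pos_le_of_pos {β : Type*} (s : Finset β) (g : β → ℝ) :
    ∃ c : ℝ, 0 < c ∧ ∀ a ∈ s, 0 < g a → c ≤ g a := by
  classical
  induction s using Finset.induction_on with
  | empty => exact ⟨1, one_pos, by simp⟩
  | insert b s _ ih =>
    obtain ⟨c, hc, h⟩ := ih
    by_cases hb : 0 < g b
    · refine ⟨min c (g b), lt_min hc hb, fun a ha hga => ?_⟩
      rcases Finset.mem_insert.1 ha with rfl | ha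
      · exact min_le_right _ _
      · exact (min_le_left _ _).trans (h a ha hga)
    · refine ⟨c, hc, fun a ha hga => ?_⟩
      rcases Finset.mem_insert.1 ha with rfl | ha
      · exact absurd hga hb
      · exact h a ha hga

open Complex MeasureTheory ProbabilityTheory Filter Topology in
theorem integrable_toMeasure {μ : PMF ℕ} {f : ℕ → ℝ} (hf : Summable fun a => (μ a).toReal * ‖f a‖) :
    Integrable f μ.toMeasure := by
  refine ⟨(measurable_of_countable f).aestronglyMeasurable, ?_⟩
  rw [HasFiniteIntegral, lintegral_countable']
  convert! hf.tsum_ofReal_lt_top using 3 with a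
  rw [μ.toMeasure_apply_singleton a (measurableSet_singleton a),
    ENNReal.ofReal_mul ENNReal.toReal_nonneg, ENNReal.ofReal_toReal (μ.apply_ne_top a),
    ofReal_norm, mul_comm]

/-- The characteristic function of the step `ξ - 1` of the walk. -/
noncomputable def walkChar (p : ℕ → ℝ) (t : ℝ) : ℂ :=
  ∑' a : ℕ, (p a : ℂ) * Complex.exp ((t * (a - 1) : ℝ) * Complex.I)

/-- A probability distribution on `ℕ` with mean `1` and finite positive variance. -/
structure IsCriticalOffspring (p : ℕ → ℝ) : Prop where
  nonneg : ∀ i, 0 ≤ p i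
  tsum_eq : ∑' i : ℕ, p i = 1
  mean_eq : ∑' i : ℕ, (i : ℝ) * p i = 1
  summable_sq : Summable fun i : ℕ => (i : ℝ) ^ 2 * p i
  one_lt : 1 < ∑' i : ℕ, (i : ℝ) ^ 2 * p i

/-- The variance of the offspring distribution `p`. -/
noncomputable def offspringVar (p : ℕ → ℝ) : ℝ := (∑' i : ℕ, (i : ℝ) ^ 2 * p i) - 1

namespace IsCriticalOffspring

open Complex MeasureTheory ProbabilityTheory Filter Topology

variable {p : ℕ → ℝ} (hp : IsCriticalOffspring p)

include hp

theorem hasSum : HasSum p 1 := by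
  rw [← hp.tsum_eq]
  refine Summable.hasSum ?_
  by_contra h
  simpa [tsum_eq_zero_of_not_summable h] using hp.tsum_eq

theorem hasSum_mean : HasSum (fun i : ℕ => (i : ℝ) * p i) 1 := by
  rw [← hp.mean_eq]
  refine Summable.hasSum ?_
  by_contra h
  simpa [tsum_eq_zero_of_not_summable h] using hp.mean_eq

theorem hasSum_step : HasSum (fun a : ℕ => p a * ((a : ℝ) - 1)) 0 := by
  simpa [mul_sub, mul_comm] using hp.hasSum_mean.sub hp.hasSum

theorem hasSum_step_sq : HasSum (fun a : ℕ => p a * ((a : ℝ) - 1) ^ 2) (offspringVar p) := by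
  have h := (hp.summable_sq.hasSum.sub (hp.hasSum_mean.mul_left 2)).add hp.hasSum
  convert! h using 1
  · ext a; ring
  · rw [offspringVar]; ring

theorem offspringVar_pos : 0 < offspringVar p := sub_pos.2 hp.one_lt

theorem zero_pos : 0 < p 0 := by
  refine (hp.nonneg 0).lt_of_ne fun h0 => ?_
  have hnn (a : ℕ) : 0 ≤ p a * ((a : ℝ) - 1) := by
    rcases a with _ | a
    · simp [← h0]
    · push_cast
      simpa using mul_nonneg (hp.nonneg _) a.cast_nonneg
  have hz := (hasSum_zero_iff_of_nonneg hnn).1 hp.hasSum_step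
  have h := hp.hasSum_step_sq
  have : (fun a : ℕ => p a * ((a : ℝ) - 1) ^ 2) = 0 := by
    ext a
    have := congrFun hz a
    simp only [Pi.zero_apply] at this
    rw [sq, ← mul_assoc, this]
    simp
  rw [this] at h
  exact hp.offspringVar_pos.ne (hasSum_zero.unique h)

theorem exists_pos : ∃ i, 0 < i ∧ 0 < p i := by
  by_contra! h
  have h' (i : ℕ) : (i : ℝ) * p i = 0 := by
    rcases i.eq_zero_or_pos with rfl | hi
    · simp
    · rw [(h i hi).antisymm (hp.nonneg i), mul_zero]
  simpa [h'] using hp.mean_eq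

theorem gcdSupp_spec : 0 < gcdSupp p ∧ ∀ i, 0 < i → 0 < p i → gcdSupp p ∣ i := by
  obtain ⟨i, hi, hpi⟩ := hp.exists_pos
  refine Nat.sSup_mem (s := {d : ℕ | 0 < d ∧ ∀ i : ℕ, 0 < i → 0 < p i → d ∣ i}) ?_ ?_
  · exact ⟨1, by simp⟩
  · exact ⟨i, fun d hd => Nat.le_of_dvd hi (hd.2 i hi hpi)⟩

theorem gcdSupp_pos : 0 < gcdSupp p := hp.gcdSupp_spec.1

theorem gcdSupp_dvd {i : ℕ} (hi : p i ≠ 0) : gcdSupp p ∣ i := by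
  rcases i.eq_zero_or_pos with rfl | h
  · exact dvd_zero _
  · exact hp.gcdSupp_spec.2 i h ((hp.nonneg i).lt_of_ne' hi)

theorem gcdSupp_mem (K : AddSubgroup ℤ) (hK : ∀ i : ℕ, p i ≠ 0 → (i : ℤ) ∈ K) :
    (gcdSupp p : ℤ) ∈ K := by
  let S : Set ℤ := (↑) '' {i : ℕ | p i ≠ 0}
  have hSK : AddSubgroup.closure S ≤ K := by
    rw [AddSubgroup.closure_le]
    rintro _ ⟨i, hi, rfl⟩
    exact hK i hi
  refine hSK ?_
  obtain ⟨g, hg⟩ := Int.subgroup_cyclic (AddSubgroup.closure S)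
  have hdvd (z : ℤ) : z ∈ AddSubgroup.closure S ↔ g ∣ z := by
    rw [hg, AddSubgroup.mem_closure_singleton]
    constructor
    · rintro ⟨n, rfl⟩
      exact ⟨n, by simp [mul_comm]⟩
    · rintro ⟨n, rfl⟩
      exact ⟨n, by simp [mul_comm]⟩
  have hgS (i : ℕ) (hi : p i ≠ 0) : g.natAbs ∣ i := by
    simpa using Int.natAbs_dvd_natAbs.2
      ((hdvd i).1 (AddSubgroup.subset_closure ⟨i, hi, rfl⟩))
  obtain ⟨i, hi, hpi⟩ := hp.exists_pos
  have hle : g.natAbs ≤ gcdSupp p := by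
    refine le_csSup (s := {d : ℕ | 0 < d ∧ ∀ i : ℕ, 0 < i → 0 < p i → d ∣ i})
      ⟨i, fun d hd => Nat.le_of_dvd hi (hd.2 i hi hpi)⟩
      ⟨Nat.pos_of_dvd_of_pos (hgS i hpi.ne') hi, fun j _ hj => hgS j hj.ne'⟩
  have hge : (gcdSupp p : ℤ) ∣ g := by
    have : AddSubgroup.closure S ≤ AddSubgroup.closure {(gcdSupp p : ℤ)} := by
      rw [AddSubgroup.closure_le]
      rintro _ ⟨i, hi, rfl⟩
      obtain ⟨n, hn⟩ := hp.gcdSupp_dvd hi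
      refine AddSubgroup.mem_closure_singleton.2 ⟨n, ?_⟩
      rw [hn]
      simp [mul_comm]
    obtain ⟨n, hn⟩ := AddSubgroup.mem_closure_singleton.1 (this ((hdvd g).2 dvd_rfl))
    exact ⟨n, by rw [← hn]; simp [mul_comm]⟩
  rw [hdvd, ← Int.natAbs_dvd_natAbs, Int.natAbs_natCast]
  have h1 := Int.natAbs_dvd_natAbs.2 hge
  rw [Int.natAbs_natCast] at h1
  rw [← Nat.dvd_antisymm h1 ?_]
  have hg0 : 0 < g.natAbs := Nat.pos_of_dvd_of_pos (hgS i hpi.ne') hi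
  exact (hle.antisymm (Nat.le_of_dvd hg0 h1)) ▸ dvd_rfl

theorem norm_walkChar_term (t : ℝ) (a : ℕ) :
    ‖(p a : ℂ) * exp ((t * (a - 1) : ℝ) * I)‖ = p a := by
  rw [norm_mul, norm_exp_ofReal_mul_I, mul_one, norm_real, Real.norm_of_nonneg (hp.nonneg a)]

theorem hasSum_walkChar (t : ℝ) :
    HasSum (fun a : ℕ => (p a : ℂ) * exp ((t * (a - 1) : ℝ) * I)) (walkChar p t) := by
  refine Summable.hasSum (.of_norm ?_)
  simpa only [hp.norm_walkChar_term t] using hp.hasSum.summable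

theorem continuous_walkChar : Continuous (walkChar p) := by
  refine continuous_tsum (fun a => by fun_prop) hp.hasSum.summable fun a t => ?_
  exact (hp.norm_walkChar_term t a).le

theorem norm_walkChar_le_one (t : ℝ) : ‖walkChar p t‖ ≤ 1 := by
  refine tsum_of_norm_bounded hp.hasSum fun a => ?_
  exact (hp.norm_walkChar_term t a).le

theorem exp_eq_one_of_norm_walkChar {t : ℝ} (ht : ‖walkChar p t‖ = 1) {a : ℕ} (ha : p a ≠ 0) :
    exp ((t * a : ℝ) * I) = 1 := by
  set u := walkChar p t with hu
  let z : ℕ → ℂ := fun a => (starRingEnd ℂ) u * exp ((t * (a - 1) : ℝ) * I)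
  have hz (a : ℕ) : ‖z a‖ = 1 := by
    simp only [z, norm_mul, RCLike.norm_conj, ht, norm_exp_ofReal_mul_I, mul_one]
  have h1 : HasSum (fun a => p a * (1 - (z a).re)) 0 := by
    have h2 := hasSum_re ((hp.hasSum_walkChar t).mul_left ((starRingEnd ℂ) u))
    rw [← hu, mul_comm _ u, mul_conj, normSq_eq_norm_sq, ht, ofReal_re] at h2
    convert! hp.hasSum.sub h2 using 1
    · ext a
      rw [mul_left_comm, re_ofReal_mul]
      ring
    · norm_num
  have h3 := (hasSum_zero_iff_of_nonneg fun a => mul_nonneg (hp.nonneg a)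
    (sub_nonneg.2 ((re_le_norm _).trans (hz a).le))).1 h1
  have hone {a : ℕ} (ha : p a ≠ 0) : z a = 1 := by
    have h4 : (z a).re = 1 := by
      have := (mul_eq_zero.1 (congrFun h3 a)).resolve_left ha
      linarith
    have h5 := normSq_eq_norm_sq (z a)
    rw [hz, normSq_apply, h4] at h5
    exact Complex.ext h4 (by simpa using h5)
  have h6 := (hone ha).trans (hone hp.zero_pos.ne').symm
  have hu0 : (starRingEnd ℂ) u ≠ 0 := by
    rw [← norm_ne_zero_iff, RCLike.norm_conj, ht]
    exact one_ne_zero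
  have h7 := mul_left_cancel₀ hu0 h6
  rw [show (t * a : ℝ) * I = (t * (a - 1) : ℝ) * I - (t * ((0 : ℕ) - 1) : ℝ) * I by
    push_cast; ring, exp_sub, h7, div_self (exp_ne_zero _)]

theorem norm_walkChar_lt_one {t : ℝ} (ht : t ≠ 0) (ht' : |t| ≤ Real.pi / gcdSupp p) :
    ‖walkChar p t‖ < 1 := by
  refine (hp.norm_walkChar_le_one t).lt_of_ne fun h1 => ?_
  let K : AddSubgroup ℤ :=
    { carrier := {z | exp ((t * z : ℝ) * I) = 1}
      zero_mem' := by simp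
      add_mem' := by
        intro a b (ha : exp _ = 1) (hb : exp _ = 1)
        change exp _ = 1
        rw [show ((t * (a + b : ℤ) : ℝ) : ℂ) * I = (t * a : ℝ) * I + (t * b : ℝ) * I by
          push_cast; ring, exp_add, ha, hb, mul_one]
      neg_mem' := by
        intro a (ha : exp _ = 1)
        change exp _ = 1
        rw [show ((t * (-a : ℤ) : ℝ) : ℂ) * I = -((t * a : ℝ) * I) by push_cast; ring,
          exp_neg, ha, inv_one] }
  have hK : exp ((t * (gcdSupp p : ℤ) : ℝ) * I) = 1 := by
    refine hp.gcdSupp_mem K fun i hi => ?_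
    change exp ((t * (i : ℤ) : ℝ) * I) = 1
    simpa using hp.exp_eq_one_of_norm_walkChar h1 hi
  obtain ⟨n, hn⟩ := exp_eq_one_iff.1 hK
  have hn' : t * gcdSupp p = n * (2 * Real.pi) := by
    have := congrArg im hn
    simpa [mul_comm, mul_assoc] using this
  have hh : (0 : ℝ) < gcdSupp p := Nat.cast_pos.2 hp.gcdSupp_pos
  have habs : |(n : ℝ)| * (2 * Real.pi) ≤ Real.pi := by
    rw [le_div_iff₀ hh] at ht'
    have := congrArg abs hn'
    rw [abs_mul, abs_mul, abs_of_pos hh, abs_of_pos Real.two_pi_pos] at this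
    linarith
  have hn1 : |(n : ℝ)| < 1 := by
    by_contra! h
    nlinarith [Real.pi_pos]
  have hn0 : n = 0 := by
    rw [← Int.abs_lt_one_iff]
    exact_mod_cast hn1
  rw [hn0] at hn'
  have : t * gcdSupp p = 0 := by simpa using hn'
  exact absurd ((mul_eq_zero.1 this).resolve_right hh.ne') ht

/-- The offspring distribution as a `PMF`. -/
noncomputable def toPMF : PMF ℕ :=
  ⟨fun a => ENNReal.ofReal (p a), by
    have := hp.hasSum
    rw [ENNReal.summable.hasSum_iff, ← ENNReal.ofReal_tsum_of_nonneg hp.nonneg this.summable,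
      this.tsum_eq, ENNReal.ofReal_one]⟩

theorem toReal_toPMF (a : ℕ) : (hp.toPMF a).toReal = p a :=
  ENNReal.toReal_ofReal (hp.nonneg a)

theorem integral_toPMF {f : ℕ → ℝ} {c : ℝ} (hf : HasSum (fun a => p a * f a) c) :
    ∫ a, f a ∂hp.toPMF.toMeasure = c := by
  rw [PMF.integral_eq_tsum]
  · simpa only [hp.toReal_toPMF, smul_eq_mul] using hf.tsum_eq
  · refine integrable_toMeasure ?_
    simpa only [hp.toReal_toPMF, Real.norm_eq_abs, abs_mul, abs_of_nonneg (hp.nonneg _)]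
      using hf.summable.abs

/-- The step of the walk, rescaled to have unit variance. -/
noncomputable def step (p : ℕ → ℝ) (a : ℕ) : ℝ := ((a : ℝ) - 1) / √(offspringVar p)

theorem integral_step : hp.toPMF.toMeasure[step p] = 0 := by
  refine hp.integral_toPMF ?_
  simpa [step, mul_div_assoc] using hp.hasSum_step.div_const (√(offspringVar p))

theorem integral_step_sq : hp.toPMF.toMeasure[step p ^ 2] = 1 := by
  refine hp.integral_toPMF ?_
  have := hp.hasSum_step_sq.div_const (offspringVar p)
  rw [div_self hp.offspringVar_pos.ne'] at this
  simpa [step, div_pow, Real.sq_sqrt hp.offspringVar_pos.le, mul_div_assoc] using this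

theorem charFun_step (t : ℝ) :
    charFun (hp.toPMF.toMeasure.map (step p)) t = walkChar p (t / √(offspringVar p)) := by
  rw [charFun_apply_real, integral_map (measurable_of_countable _).aemeasurable (by fun_prop),
    PMF.integral_eq_tsum, walkChar]
  · refine tsum_congr fun a => ?_
    rw [hp.toReal_toPMF, real_smul, step]
    push_cast
    ring_nf
  · refine Integrable.of_bound (measurable_of_countable _).aestronglyMeasurable 1 (ae_of_all _ ?_)
    intro a
    rw [← ofReal_mul, norm_exp_ofReal_mul_I]

theorem tendsto_walkChar_pow (s : ℝ) :
    Tendsto (fun m : ℕ => walkChar p (s / √m) ^ m) atTop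
      (𝓝 (Real.exp (-(offspringVar p / 2) * s ^ 2) : ℝ)) := by
  have hσ := hp.offspringVar_pos
  have h := tendsto_charFun_inv_sqrt_mul_pow (measurable_of_countable (step p)).aemeasurable
    hp.integral_step hp.integral_step_sq (√(offspringVar p) * s)
  simp only [hp.charFun_step] at h
  convert! h using 2
  · congr 2
    field_simp
  · rw [ofReal_exp]
    congr 1
    push_cast
    have hsq : ((√(offspringVar p) : ℝ) : ℂ) ^ 2 = offspringVar p := by
      rw [← ofReal_pow, Real.sq_sqrt hσ.le]
    rw [mul_pow, hsq]
    ring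

theorem exists_norm_walkChar_le_near_zero : ∃ δ > 0, ∀ t : ℝ, |t| < δ →
    ‖walkChar p t‖ ≤ Real.exp (-(offspringVar p / 4) * t ^ 2) := by
  have hσ := hp.offspringVar_pos
  have hs : 0 < √(offspringVar p) := Real.sqrt_pos.2 hσ
  have h := taylor_charFun_two (measurable_of_countable (step p)).aemeasurable
    hp.integral_step hp.integral_step_sq
  have hc : Tendsto (fun t : ℝ => √(offspringVar p) * t) (𝓝 0) (𝓝 0) := by
    simpa using (continuous_const_mul (√(offspringVar p))).tendsto 0
  have h2 := (h.comp_tendsto hc).bound (show (0 : ℝ) < 1 / 4 by norm_num)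
  have h3 : ∀ᶠ t : ℝ in 𝓝 0, offspringVar p * t ^ 2 < 1 := by
    have : Continuous fun t : ℝ => offspringVar p * t ^ 2 := by fun_prop
    exact this.continuousAt.eventually_lt_const (by simp)
  obtain ⟨δ, hδ, hb⟩ := Metric.eventually_nhds_iff.1 (h2.and h3)
  refine ⟨δ, hδ, fun t ht => ?_⟩
  obtain ⟨h4, h5⟩ := hb (y := t) (by simpa using ht)
  simp only [Function.comp_apply, hp.charFun_step, mul_div_cancel_left₀ _ hs.ne',
    Real.norm_eq_abs, mul_pow, Real.sq_sqrt hσ.le] at h4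
  rw [abs_of_nonneg (by positivity)] at h4
  have h6 : ‖(1 - ((√(offspringVar p) * t : ℝ) : ℂ) ^ 2 / 2)‖ = 1 - offspringVar p * t ^ 2 / 2 := by
    rw [← ofReal_pow, mul_pow, Real.sq_sqrt hσ.le]
    have : (1 - ((offspringVar p * t ^ 2 : ℝ) : ℂ) / 2) =
      ((1 - offspringVar p * t ^ 2 / 2 : ℝ) : ℂ) := by push_cast; ring
    rw [this, norm_real, Real.norm_of_nonneg]
    linarith
  have h7 := norm_le_norm_sub_add (walkChar p t) (1 - ((√(offspringVar p) * t : ℝ) : ℂ) ^ 2 / 2)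
  rw [h6] at h7
  have h8 := Real.add_one_le_exp (-(offspringVar p / 4) * t ^ 2)
  linarith

theorem exists_norm_walkChar_le : ∃ c > 0, ∀ t : ℝ, |t| ≤ Real.pi / gcdSupp p →
    ‖walkChar p t‖ ≤ Real.exp (-c * t ^ 2) := by
  obtain ⟨δ, hδ, hnear⟩ := hp.exists_norm_walkChar_le_near_zero
  have hσ := hp.offspringVar_pos
  set L := Real.pi / gcdSupp p with hL
  have hLpos : 0 < L := div_pos Real.pi_pos (Nat.cast_pos.2 hp.gcdSupp_pos)
  let s : Set ℝ := Metric.closedBall 0 L \ Metric.ball 0 δ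
  have hs : IsCompact s := (isCompact_closedBall 0 L).diff Metric.isOpen_ball
  obtain ⟨r, hr1, hr⟩ : ∃ r < 1, ∀ t ∈ s, ‖walkChar p t‖ ≤ r := by
    rcases s.eq_empty_or_nonempty with he | hne
    · exact ⟨0, one_pos, by simp [he]⟩
    · obtain ⟨t₀, ht₀, hmax⟩ := hs.exists_isMaxOn hne hp.continuous_walkChar.norm.continuousOn
      refine ⟨‖walkChar p t₀‖, hp.norm_walkChar_lt_one ?_ ?_, fun t ht => hmax ht⟩
      · rintro rfl
        exact ht₀.2 (by simpa using hδ)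
      · simpa using ht₀.1
  refine ⟨min (offspringVar p / 4) ((1 - r) / L ^ 2), by
    have : 0 < 1 - r := by linarith
    positivity, fun t ht => ?_⟩
  by_cases htδ : |t| < δ
  · refine (hnear t htδ).trans (Real.exp_le_exp.2 ?_)
    have := mul_le_mul_of_nonneg_right
      (min_le_left (offspringVar p / 4) ((1 - r) / L ^ 2)) (sq_nonneg t)
    linarith
  · have h1 := hr t ⟨by simpa using ht, by simpa using htδ⟩
    have h2 : min (offspringVar p / 4) ((1 - r) / L ^ 2) * t ^ 2 ≤ 1 - r := by
      calc _ ≤ (1 - r) / L ^ 2 * L ^ 2 := by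
            refine mul_le_mul (min_le_right _ _) (sq_le_sq.2 ?_) (sq_nonneg t) ?_
            · rwa [abs_of_pos hLpos]
            · have : 0 < 1 - r := by linarith
              positivity
        _ = 1 - r := by field_simp
    have h3 := Real.add_one_le_exp (-(min (offspringVar p / 4) ((1 - r) / L ^ 2)) * t ^ 2)
    linarith

theorem gcdSupp_dvd_of_walkProb_pos {m : ℕ} {x : ℤ} (h : 0 < walkProb p m x) :
    (gcdSupp p : ℤ) ∣ m + x := by
  induction m generalizing x with
  | zero =>
    by_cases hx : x = 0
    · simp [hx]
    · simp [walkProb, Ne.symm hx] at h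
  | succ m ih =>
    by_contra hd
    have h0 : (fun a : ℕ => p a * walkProb p m (x - (a - 1))) = 0 := by
      ext a
      by_contra hne
      obtain ⟨ha, hw⟩ := mul_ne_zero_iff.1 hne
      have h1 := ih ((walkProb_nonneg hp.nonneg _ _).lt_of_ne' hw)
      have h2 := h1.add (Int.natCast_dvd_natCast.2 (hp.gcdSupp_dvd ha))
      refine hd ?_
      convert! h2 using 1
      push_cast
      ring
    have := hasSum_walkProb p m x
    rw [h0] at this
    exact h.ne (hasSum_zero.unique this)

theorem integral_exp_int_mul {L : ℝ} (hL : L = Real.pi / gcdSupp p) {x : ℤ}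
    (hx : (gcdSupp p : ℤ) ∣ x) :
    ∫ t in -L..L, exp ((-(t * x) : ℝ) * I) = if x = 0 then (2 * L : ℂ) else 0 := by
  have hh : (gcdSupp p : ℝ) ≠ 0 := Nat.cast_ne_zero.2 hp.gcdSupp_pos.ne'
  split_ifs with h0
  · simp [h0, two_mul]
  · obtain ⟨j, rfl⟩ := hx
    have hc : -((gcdSupp p * j : ℤ) : ℂ) * I ≠ 0 := by
      refine mul_ne_zero (neg_ne_zero.2 ?_) I_ne_zero
      exact_mod_cast h0
    have h1 (t : ℝ) : ((-(t * (gcdSupp p * j : ℤ)) : ℝ) : ℂ) * I =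
        -((gcdSupp p * j : ℤ) : ℂ) * I * t := by push_cast; ring
    simp only [h1]
    rw [integral_exp_mul_complex hc]
    have hh' : (gcdSupp p : ℂ) ≠ 0 := Nat.cast_ne_zero.2 hp.gcdSupp_pos.ne'
    have h2 : exp (-((gcdSupp p * j : ℤ) : ℂ) * I * L) =
        exp (-((gcdSupp p * j : ℤ) : ℂ) * I * (-L : ℝ)) := by
      rw [exp_eq_exp_iff_exists_int]
      refine ⟨-j, ?_⟩
      rw [hL]
      push_cast
      field_simp
      ring
    rw [h2, sub_self, zero_div]

/-- Fourier inversion for the walk, on the dual of its lattice. -/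
theorem walkProb_eq_integral {L : ℝ} (hL : L = Real.pi / gcdSupp p) (m : ℕ) {x : ℤ}
    (hx : (gcdSupp p : ℤ) ∣ m + x) :
    ∫ t in -L..L, walkChar p t ^ m * exp ((-(t * x) : ℝ) * I) = 2 * L * walkProb p m x := by
  induction m generalizing x with
  | zero =>
    simp only [pow_zero, one_mul]
    rw [hp.integral_exp_int_mul hL (by simpa using hx)]
    by_cases h : x = 0
    · simp [walkProb, h]
    · simp [walkProb, h, Ne.symm h]
  | succ m ih =>
    have h1 : HasSum (fun a : ℕ => ∫ t in -L..L, (p a : ℂ) *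
          (walkChar p t ^ m * exp ((-(t * (x - (a - 1) : ℤ)) : ℝ) * I)))
        (∫ t in -L..L, walkChar p t ^ (m + 1) * exp ((-(t * x) : ℝ) * I)) := by
      have hcont := hp.continuous_walkChar
      refine intervalIntegral.hasSum_integral_of_dominated_convergence (fun a _ => p a)
        (fun a => ?_) (fun a => ?_) ?_ ?_ ?_
      · exact (by fun_prop : Continuous _).aestronglyMeasurable
      · refine ae_of_all _ fun t _ => ?_
        rw [norm_mul, norm_mul, norm_pow, norm_exp_ofReal_mul_I, mul_one, norm_real,
          Real.norm_of_nonneg (hp.nonneg a)]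
        exact mul_le_of_le_one_right (hp.nonneg a)
          (pow_le_one₀ (norm_nonneg _) (hp.norm_walkChar_le_one t))
      · exact ae_of_all _ fun _ _ => hp.hasSum.summable
      · exact intervalIntegrable_const
      · refine ae_of_all _ fun t _ => ?_
        have h2 := (hp.hasSum_walkChar t).mul_right
          (walkChar p t ^ m * exp ((-(t * x) : ℝ) * I))
        rw [← mul_assoc, ← pow_succ'] at h2
        convert! h2 using 2 with a
        rw [mul_assoc]
        congr 1
        rw [mul_left_comm, ← exp_add]
        congr 2
        push_cast
        ring
    have h3 : HasSum (fun a : ℕ => ∫ t in -L..L, (p a : ℂ) *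
          (walkChar p t ^ m * exp ((-(t * (x - (a - 1) : ℤ)) : ℝ) * I)))
        (2 * L * walkProb p (m + 1) x) := by
      have h4 := (Complex.hasSum_ofReal.2 (hasSum_walkProb p m x)).mul_left (2 * L : ℂ)
      convert! h4 using 2 with a
      rw [intervalIntegral.integral_const_mul]
      by_cases ha : p a = 0
      · simp [ha]
      · rw [ih]
        · push_cast
          ring
        · have := hx.sub (Int.natCast_dvd_natCast.2 (hp.gcdSupp_dvd ha))
          convert! this using 1
          push_cast
          ring
    exact h1.unique h3

theorem tendsto_sqrt_mul_integral {L : ℝ} (hL : L = Real.pi / gcdSupp p) (x : ℤ) :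
    Tendsto (fun m : ℕ => (√m : ℂ) * ∫ t in -L..L, walkChar p t ^ m * exp ((-(t * x) : ℝ) * I))
      atTop (𝓝 (√(Real.pi / (offspringVar p / 2)) : ℝ)) := by
  obtain ⟨c, hc, hbound⟩ := hp.exists_norm_walkChar_le
  have hLpos : 0 < L := hL ▸ div_pos Real.pi_pos (Nat.cast_pos.2 hp.gcdSupp_pos)
  have hcont := hp.continuous_walkChar
  let f : ℕ → ℝ → ℂ := fun m => (Set.Ioc (-L * √m) (L * √m)).indicator
    fun s => walkChar p (s / √m) ^ m * exp ((-(s / √m * x) : ℝ) * I)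
  have hf : Tendsto (fun m => ∫ s, f m s) atTop
      (𝓝 (∫ s : ℝ, ((Real.exp (-(offspringVar p / 2) * s ^ 2) : ℝ) : ℂ))) := by
    refine tendsto_integral_filter_of_dominated_convergence (fun s => Real.exp (-c * s ^ 2))
      (Eventually.of_forall fun m => ?_) ?_ (integrable_exp_neg_mul_sq hc) (ae_of_all _ fun s => ?_)
    · refine AEStronglyMeasurable.indicator ?_ measurableSet_Ioc
      exact (by fun_prop : Continuous _).aestronglyMeasurable
    · filter_upwards [eventually_gt_atTop 0] with m hm
      refine ae_of_all _ fun s => ?_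
      have hm' : (0 : ℝ) < √m := Real.sqrt_pos.2 (Nat.cast_pos.2 hm)
      simp only [f]
      by_cases hs : s ∈ Set.Ioc (-L * √m) (L * √m)
      · rw [Set.indicator_of_mem hs, norm_mul, norm_exp_ofReal_mul_I, mul_one, norm_pow]
        have h1 : |s / √m| ≤ Real.pi / gcdSupp p := by
          rw [← hL, abs_div, abs_of_pos hm', div_le_iff₀ hm', abs_le, ← neg_mul]
          exact ⟨hs.1.le, hs.2⟩
        refine (pow_le_pow_left₀ (norm_nonneg _) (hbound _ h1) m).trans ?_
        rw [← Real.exp_nat_mul, div_pow, Real.sq_sqrt (Nat.cast_nonneg m)]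
        refine (congrArg Real.exp ?_).le
        field_simp
      · rw [Set.indicator_of_notMem hs, norm_zero]
        positivity
    · have hsqrt : Tendsto (fun m : ℕ => √(m : ℝ)) atTop atTop :=
        Real.tendsto_sqrt_atTop.comp tendsto_natCast_atTop_atTop
      have h1 : Tendsto (fun m : ℕ => s / √(m : ℝ)) atTop (𝓝 0) :=
        tendsto_const_nhds.div_atTop hsqrt
      have h2 : Tendsto (fun m : ℕ => exp ((-(s / √m * x) : ℝ) * I)) atTop (𝓝 1) := by
        have hcts : Continuous fun t : ℝ => exp ((-(t * x) : ℝ) * I) := by fun_prop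
        simpa [Function.comp_def] using (hcts.tendsto 0).comp h1
      have h3 := (hp.tendsto_walkChar_pow s).mul h2
      rw [mul_one] at h3
      refine h3.congr' ?_
      filter_upwards [hsqrt.eventually_gt_atTop (|s| / L)] with m hm
      rw [div_lt_iff₀ hLpos, mul_comm] at hm
      have := abs_lt.1 hm
      simp only [f]
      rw [Set.indicator_of_mem]
      exact ⟨by linarith, this.2.le⟩
  rw [integral_complex_ofReal, integral_gaussian] at hf
  refine hf.congr' ?_
  filter_upwards [eventually_gt_atTop 0] with m hm
  have hm' : (0 : ℝ) < √m := Real.sqrt_pos.2 (Nat.cast_pos.2 hm)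
  simp only [f]
  rw [integral_indicator measurableSet_Ioc, ← intervalIntegral.integral_of_le (by nlinarith),
    intervalIntegral.integral_comp_div
      (fun t : ℝ => walkChar p t ^ m * exp ((-(t * x) : ℝ) * I)) hm'.ne',
    mul_div_cancel_right₀ _ hm'.ne', mul_div_cancel_right₀ _ hm'.ne', real_smul]

/-- The local limit theorem. -/
theorem exists_abs_sqrt_mul_walkProb_sub_le (x : ℤ) {ε : ℝ} (hε : 0 < ε) :
    ∃ M : ℕ, ∀ m ≥ M, 0 < walkProb p m x → |√m * walkProb p m x - gwAlpha p| ≤ ε := by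
  have hh : (0 : ℝ) < gcdSupp p := Nat.cast_pos.2 hp.gcdSupp_pos
  have hσ := hp.offspringVar_pos
  have hL0 : 0 < Real.pi / gcdSupp p := div_pos Real.pi_pos hh
  have h := hp.tendsto_sqrt_mul_integral rfl x
  obtain ⟨M, hM⟩ := Metric.tendsto_atTop.1 h (ε * (2 * (Real.pi / gcdSupp p))) (by positivity)
  refine ⟨M, fun m hm hpos => ?_⟩
  have h1 := hM m hm
  have hα : √(Real.pi / (offspringVar p / 2)) = 2 * (Real.pi / gcdSupp p) * gwAlpha p := by
    rw [gwAlpha, ← offspringVar, Real.sqrt_eq_iff_mul_self_eq (by positivity) (by positivity)]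
    have h2 := Real.sq_sqrt hσ.le
    have h3 := Real.sq_sqrt (show 0 ≤ Real.pi * 2 by positivity)
    have h4 : 0 < √(offspringVar p) := Real.sqrt_pos.2 hσ
    have h5 : 0 < √(2 * Real.pi) := Real.sqrt_pos.2 Real.two_pi_pos
    field_simp
    rw [h3, h2]
    ring
  rw [hp.walkProb_eq_integral rfl m (hp.gcdSupp_dvd_of_walkProb_pos hpos), hα, dist_eq,
    show (√m : ℂ) * (2 * ((Real.pi / gcdSupp p : ℝ) : ℂ) * walkProb p m x) -
      ((2 * (Real.pi / gcdSupp p) * gwAlpha p : ℝ) : ℂ) =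
      ((2 * (Real.pi / gcdSupp p) * (√m * walkProb p m x - gwAlpha p) : ℝ) : ℂ) by
    push_cast; ring, norm_real, Real.norm_eq_abs, abs_mul, abs_of_pos (by positivity),
    mul_comm] at h1
  exact (lt_of_mul_lt_mul_right h1 (by positivity)).le

theorem gwAlpha_pos : 0 < gwAlpha p := by
  have hh : (0 : ℝ) < gcdSupp p := Nat.cast_pos.2 hp.gcdSupp_pos
  have hσ := hp.offspringVar_pos
  rw [gwAlpha, ← offspringVar]
  positivity

end IsCriticalOffspring

namespace IsCriticalOffspring

variable {p : ℕ → ℝ} (hp : IsCriticalOffspring p)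

include hp

theorem exists_walkProb_bounds (x : ℤ) : ∃ M : ℕ, 1 ≤ M ∧ ∀ m ≥ M,
    walkProb p m x ≤ 6 / 5 * gwAlpha p / √m ∧
      (0 < walkProb p m x → 4 / 5 * gwAlpha p / √m ≤ walkProb p m x) := by
  have hα := hp.gwAlpha_pos
  obtain ⟨M, hM⟩ := hp.exists_abs_sqrt_mul_walkProb_sub_le x (show 0 < gwAlpha p / 5 by positivity)
  refine ⟨max M 1, le_max_right _ _, fun m hm => ?_⟩
  have hm' : (0 : ℝ) < √m := Real.sqrt_pos.2 (Nat.cast_pos.2 (by omega))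
  rw [le_div_iff₀ hm', div_le_iff₀ hm']
  rcases (walkProb_nonneg hp.nonneg m x).eq_or_lt with h | h
  · simp [← h]
    positivity
  · have := abs_le.1 (hM m (by omega) h)
    constructor <;> intros <;> linarith

theorem exists_condExp_zk_bounds : ∃ M : ℕ, 1 ≤ M ∧ ∀ n k : ℕ, M ≤ k → k + M ≤ n →
    n ∈ gwSupport p → k ∈ walkSupportIn p n →
      condExp p n (fun T => (Zk k T : ℝ)) ≤
        9 / 5 * gwAlpha p * (√n ^ 3 / (√(n - k : ℝ) * √k ^ 3)) ∧
      (k ∈ gwSupport p → 8 / 15 * gwAlpha p * (√n ^ 3 / (√(n - k : ℝ) * √k ^ 3)) ≤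
        condExp p n (fun T => (Zk k T : ℝ))) := by
  have hα := hp.gwAlpha_pos
  obtain ⟨M₀, hM₀, h₀⟩ := hp.exists_walkProb_bounds 0
  obtain ⟨M₁, -, h₁⟩ := hp.exists_walkProb_bounds (-1)
  refine ⟨max M₀ M₁, by omega, fun n k hk hkn hn hkw => ?_⟩
  have hkpos : (0 : ℝ) < √k := Real.sqrt_pos.2 (Nat.cast_pos.2 (by omega))
  have hnpos : (0 : ℝ) < √n := Real.sqrt_pos.2 (Nat.cast_pos.2 (by omega))
  have hnkpos : (0 : ℝ) < √(n - k : ℝ) := Real.sqrt_pos.2 (sub_pos.2 (Nat.cast_lt.2 (by omega)))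
  have hWn := (h₁ n (by omega)).2 (walkProb_pos_of_mem_gwSupport hn)
  have hWk := h₁ k (by omega)
  have hW := h₀ (n - k) (by omega)
  rw [Nat.cast_sub hkw.2.1] at hW
  have hWn' := (h₁ n (by omega)).1
  have hE : condExp p n (fun T => (Zk k T : ℝ)) = √n ^ 2 / √k ^ 2 *
      (walkProb p k (-1) * walkProb p (n - k) 0 / walkProb p n (-1)) := by
    rw [condExp_zk p hkw.1 hkw.2.1, ← mul_treeSum p k, ← mul_treeSum p n,
      Real.sq_sqrt (Nat.cast_nonneg _), Real.sq_sqrt (Nat.cast_nonneg _)]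
    have := hn.2
    have hk0 : (k : ℝ) ≠ 0 := Nat.cast_ne_zero.2 (by omega)
    have hn0 : (n : ℝ) ≠ 0 := Nat.cast_ne_zero.2 (by omega)
    field_simp
  have hk0 := walkProb_nonneg hp.nonneg k (-1)
  have hW0 := walkProb_nonneg hp.nonneg (n - k) 0
  have hnpos' := walkProb_pos_of_mem_gwSupport hn
  rw [hE]
  constructor
  · calc _ ≤ √n ^ 2 / √k ^ 2 * ((6 / 5 * gwAlpha p / √k) * (6 / 5 * gwAlpha p / √(n - k : ℝ)) /
          (4 / 5 * gwAlpha p / √n)) := by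
          gcongr
          · exact hWk.1
          · exact hW.1
      _ = _ := by
        field_simp
        norm_num
  · intro hkI
    calc _ = √n ^ 2 / √k ^ 2 * ((4 / 5 * gwAlpha p / √k) * (4 / 5 * gwAlpha p / √(n - k : ℝ)) /
          (6 / 5 * gwAlpha p / √n)) := by
          field_simp
          norm_num
      _ ≤ _ := by
        gcongr
        · exact hWk.2 (walkProb_pos_of_mem_gwSupport hkI)
        · exact hW.2 hkw.2.2

theorem exists_condExp_zk_upper : ∃ n₀ : ℕ, 1 ≤ n₀ ∧ ∀ n k : ℕ,
    n ∈ gwSupport p → k ∈ walkSupportIn p n →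
      ((n : ℝ) / 2 ≤ k → k + n₀ ≤ n → condExp p n (fun T => (Zk k T : ℝ)) ≤
        4 * √2 * gwAlpha p * (1 / √(n - k : ℝ))) ∧
      (n₀ ≤ k → (k : ℝ) ≤ n / 2 → condExp p n (fun T => (Zk k T : ℝ)) ≤
        2 * √2 * gwAlpha p * n * (1 / √k ^ 3)) := by
  have hα := hp.gwAlpha_pos
  obtain ⟨M, hM, h⟩ := hp.exists_condExp_zk_bounds
  refine ⟨M, hM, fun n k hn hk => ⟨fun hnk hkM => ?_, fun hkM hnk => ?_⟩⟩
  · have hle : n ≤ 2 * k := by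
      rify
      linarith
    have hkpos : (0 : ℝ) < √k := Real.sqrt_pos.2 (Nat.cast_pos.2 hk.1)
    have hnkpos : (0 : ℝ) < √(n - k : ℝ) :=
      Real.sqrt_pos.2 (sub_pos.2 (Nat.cast_lt.2 (by omega)))
    have h1 : √n ≤ √2 * √k := by
      rw [← Real.sqrt_mul (by norm_num)]
      exact Real.sqrt_le_sqrt (by linarith)
    refine (h n k (by omega) hkM hn hk).1.trans ?_
    calc _ ≤ 9 / 5 * gwAlpha p * ((√2 * √k) ^ 3 / (√(n - k : ℝ) * √k ^ 3)) := by gcongr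
      _ = 18 / 5 * √2 * gwAlpha p * (1 / √(n - k : ℝ)) := by
        have := Real.sq_sqrt (show (0 : ℝ) ≤ 2 by norm_num)
        field_simp
        rw [this]
        norm_num
      _ ≤ _ := by gcongr; norm_num
  · have hle : 2 * k ≤ n := by
      rify
      linarith
    have hkpos : (0 : ℝ) < √k := Real.sqrt_pos.2 (Nat.cast_pos.2 hk.1)
    have hnkpos : (0 : ℝ) < √(n - k : ℝ) := by
      refine Real.sqrt_pos.2 (sub_pos.2 (Nat.cast_lt.2 ?_))
      have := hk.1
      omega
    have h1 : √n ≤ √2 * √(n - k : ℝ) := by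
      rw [← Real.sqrt_mul (by norm_num)]
      exact Real.sqrt_le_sqrt (by linarith)
    refine (h n k hkM (by omega) hn hk).1.trans ?_
    calc _ = 9 / 5 * gwAlpha p * (√n * √n ^ 2 / (√(n - k : ℝ) * √k ^ 3)) := by ring
      _ ≤ 9 / 5 * gwAlpha p * (√2 * √(n - k : ℝ) * √n ^ 2 / (√(n - k : ℝ) * √k ^ 3)) := by gcongr
      _ = 9 / 5 * √2 * gwAlpha p * n * (1 / √k ^ 3) := by
        rw [Real.sq_sqrt (Nat.cast_nonneg n)]
        field_simp
      _ ≤ _ := by gcongr; norm_num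

theorem exists_condExp_zk_lower : ∃ n₁ : ℕ, 1 ≤ n₁ ∧ ∀ n k : ℕ,
    n ∈ gwSupport p → k ∈ walkSupportIn p n → k ∈ gwSupport p → n₁ ≤ k → (k : ℝ) ≤ n / 2 →
      gwAlpha p * n * (1 / √k ^ 3) / 2 ≤ condExp p n (fun T => (Zk k T : ℝ)) := by
  have hα := hp.gwAlpha_pos
  obtain ⟨M, hM, h⟩ := hp.exists_condExp_zk_bounds
  refine ⟨M, hM, fun n k hn hk hkI hkM hnk => ?_⟩
  have hle : 2 * k ≤ n := by
    rify
    linarith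
  have hkpos : (0 : ℝ) < √k := Real.sqrt_pos.2 (Nat.cast_pos.2 hk.1)
  have hnkpos : (0 : ℝ) < √(n - k : ℝ) := by
    refine Real.sqrt_pos.2 (sub_pos.2 (Nat.cast_lt.2 ?_))
    have := hk.1
    omega
  have h1 : √(n - k : ℝ) ≤ √n := Real.sqrt_le_sqrt (by linarith [k.cast_nonneg (α := ℝ)])
  refine le_trans ?_ ((h n k hkM (by omega) hn hk).2 hkI)
  calc _ = 1 / 2 * gwAlpha p * (√(n - k : ℝ) * √n ^ 2 / (√(n - k : ℝ) * √k ^ 3)) := by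
        rw [Real.sq_sqrt (Nat.cast_nonneg n)]
        field_simp
    _ ≤ 8 / 15 * gwAlpha p * (√n * √n ^ 2 / (√(n - k : ℝ) * √k ^ 3)) := by
        gcongr ?_ * _ * (?_ * _ / _)
        norm_num
    _ = _ := by ring

theorem exists_mul_le_condExp_zk (K : ℕ) : ∃ c : ℝ, 0 < c ∧ ∀ n k : ℕ,
    n ∈ gwSupport p → k ∈ walkSupportIn p n → k ∈ gwSupport p → k ≤ K →
      c * n ≤ condExp p n (fun T => (Zk k T : ℝ)) := by
  have hα := hp.gwAlpha_pos
  obtain ⟨M₀, hM₀, h₀⟩ := hp.exists_walkProb_bounds 0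
  obtain ⟨M₁, -, h₁⟩ := hp.exists_walkProb_bounds (-1)
  set N := max (M₀ + K) M₁
  obtain ⟨c₁, hc₁, hle₁⟩ := exists_pos_le_of_pos (Finset.range (K + 1)) (treeSum p)
  obtain ⟨c₂, hc₂, hle₂⟩ := exists_pos_le_of_pos (Finset.range N ×ˢ Finset.range (K + 1))
    fun q => condExp p q.1 (fun T => (Zk q.2 T : ℝ)) / q.1
  refine ⟨min (2 / 3 * c₁) c₂, by positivity, fun n k hn hk hkI hkK => ?_⟩
  have hn0 : (0 : ℝ) < n := Nat.cast_pos.2 hn.1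
  rcases lt_or_ge n N with hnN | hnN
  · refine (mul_le_mul_of_nonneg_right (min_le_right _ _) hn0.le).trans ?_
    rw [← le_div_iff₀ hn0]
    refine hle₂ (n, k) (by simp; omega) ?_
    rw [condExp_zk p hk.1 hk.2.1]
    exact div_pos (div_pos (mul_pos hkI.2 hk.2.2) hn.2) hn0
  · have hnpos : (0 : ℝ) < √n := Real.sqrt_pos.2 hn0
    have hnkpos : (0 : ℝ) < √(n - k : ℝ) :=
      Real.sqrt_pos.2 (sub_pos.2 (Nat.cast_lt.2 (by omega)))
    have hW := (h₀ (n - k) (by omega)).2 hk.2.2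
    rw [Nat.cast_sub hk.2.1] at hW
    have hWn := (h₁ n (by omega)).1
    have h1 : √(n - k : ℝ) ≤ √n := Real.sqrt_le_sqrt (by linarith [k.cast_nonneg (α := ℝ)])
    have hlt : c₁ ≤ treeSum p k := hle₁ k (by simp; omega) hkI.2
    have hnpos' := walkProb_pos_of_mem_gwSupport hn
    have hk0 := hkI.2.le
    have hW0 := hk.2.2.le
    calc _ ≤ 2 / 3 * c₁ * n := mul_le_mul_of_nonneg_right (min_le_left _ _) hn0.le
      _ = n * (c₁ * (4 / 5 * gwAlpha p / √n) / (6 / 5 * gwAlpha p / √n)) := by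
        field_simp
        norm_num
      _ ≤ n * (treeSum p k * (4 / 5 * gwAlpha p / √(n - k : ℝ)) / (6 / 5 * gwAlpha p / √n)) := by
        gcongr
      _ ≤ n * (treeSum p k * walkProb p (n - k) 0 / walkProb p n (-1)) := by
        gcongr
      _ = _ := by
        have := hn.2
        rw [condExp_zk p hk.1 hk.2.1, ← mul_treeSum p n]
        field_simp

end IsCriticalOffspring

end

/-- upper and lower bounds for `E_{τ_n}[Z_k]`. -/
theorem stmt_1 (p : ℕ → ℝ)
    (hp_nonneg : ∀ i, 0 ≤ p i)
    (hp_sum : ∑' i : ℕ, p i = 1)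
    (hp_mean : ∑' i : ℕ, (i : ℝ) * p i = 1)
    (hp_sq : Summable (fun i : ℕ => (i : ℝ) ^ 2 * p i))
    (hp_var : 1 < ∑' i : ℕ, (i : ℝ) ^ 2 * p i) :
    (∃ n₀ : ℕ, 1 ≤ n₀ ∧ ∀ n : ℕ, n₀ ≤ n → n ∈ gwSupport p →
      ∀ k ∈ walkSupportIn p n,
        ((n : ℝ) / 2 ≤ (k : ℝ) → k + n₀ ≤ n →
            condExp p n (fun T => (Zk k T : ℝ)) ≤
              4 * Real.sqrt 2 * gwAlpha p * ((n : ℝ) - (k : ℝ)) ^ (-(1 : ℝ) / 2))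
        ∧ (n₀ ≤ k → (k : ℝ) ≤ (n : ℝ) / 2 →
            condExp p n (fun T => (Zk k T : ℝ)) ≤
              2 * Real.sqrt 2 * gwAlpha p * (n : ℝ) * (k : ℝ) ^ (-(3 : ℝ) / 2))
        ∧ condExp p n (fun T => (Zk k T : ℝ)) ≤ ((n / k : ℕ) : ℝ))
    ∧ (∃ n₁ : ℕ, ∃ ς : ℝ, 1 ≤ n₁ ∧ 0 < ς ∧ ∀ n : ℕ, n₁ ≤ n → n ∈ gwSupport p →
        ∀ k, k ∈ walkSupportIn p n → k ∈ gwSupport p →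
          ((n₁ ≤ k → (k : ℝ) ≤ (n : ℝ) / 2 →
              gwAlpha p * (n : ℝ) * (k : ℝ) ^ (-(3 : ℝ) / 2) / 2 ≤
                condExp p n (fun T => (Zk k T : ℝ)))
          ∧ (k ≤ n₁ → ς * (n : ℝ) ≤ condExp p n (fun T => (Zk k T : ℝ))))) := by
  have hp : IsCriticalOffspring p := ⟨hp_nonneg, hp_sum, hp_mean, hp_sq, hp_var⟩
  have hpow_half {x : ℝ} (hx : 0 ≤ x) : x ^ (-(1 : ℝ) / 2) = 1 / √x := by
    rw [neg_div, Real.rpow_neg hx, Real.sqrt_eq_rpow, one_div (_ ^ _)]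
  have hpow_three_half (k : ℕ) : (k : ℝ) ^ (-(3 : ℝ) / 2) = 1 / √k ^ 3 := by
    rw [neg_div, Real.rpow_neg k.cast_nonneg, Real.sqrt_eq_rpow, ← Real.rpow_mul_natCast
      k.cast_nonneg, one_div]
    norm_num
  constructor
  · obtain ⟨n₀, hn₀, h⟩ := hp.exists_condExp_zk_upper
    refine ⟨n₀, hn₀, fun n _ hn k hk => ?_⟩
    rw [hpow_three_half, hpow_half (sub_nonneg.2 (Nat.cast_le.2 hk.2.1))]
    exact ⟨(h n k hn hk).1, (h n k hn hk).2, condExp_zk_le hp_nonneg hk.1 hn⟩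
  · obtain ⟨n₁, hn₁, h⟩ := hp.exists_condExp_zk_lower
    obtain ⟨c, hc, h'⟩ := hp.exists_mul_le_condExp_zk n₁
    refine ⟨n₁, c, hn₁, hc, fun n _ hn k hk hkI => ?_⟩
    rw [hpow_three_half]
    exact ⟨h n k hn hk hkI, h' n k hn hk hkI⟩
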